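/- arXiv:0809.4055 — 5 statements merged into one kernel-verified Lean document; each statement's English description precedes it below -/
import Mathlib

section
/- Every linear automorphism of ℝ⁷ preserving the standard G₂ 3-form φ₀ is orthogonal: if A : ℝ⁷ → ℝ⁷ is a linear equivalence such that φ₀(Au, Av, Aw) = φ₀(u, v, w) for all u, v, w ∈ ℝ⁷, then ⟨Au, Av⟩ = ⟨u, v⟩ for all u, v ∈ ℝ⁷. (This is the pointwise content of the paper's assertion that G₂, defined as the stabiliser in GL(ℝ⁷) of φ₀, is contained in SO(7), so that a G₂-structure naturally defines a Riemannian metric.) -/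
/-- The alternating 3-form `dx^i ∧ dx^j ∧ dx^k` on `ℝ⁷`, evaluated on `u, v, w`. -/
noncomputable def dxdxdx (i j k : Fin 7) (u v w : Fin 7 → ℝ) : ℝ :=
  Matrix.det !![u i, u j, u k; v i, v j, v k; w i, w j, w k]

/-- The standard `G₂` 3-form `φ₀` on `ℝ⁷`, as a trilinear function.
(Indices `1,…,7` of the paper correspond to `0,…,6` of `Fin 7`.) -/
noncomputable def phi0 (u v w : Fin 7 → ℝ) : ℝ :=
  dxdxdx 0 1 2 u v w + dxdxdx 0 3 4 u v w + dxdxdx 0 5 6 u v w + dxdxdx 1 3 5 u v w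
    - dxdxdx 1 4 6 u v w - dxdxdx 2 3 6 u v w - dxdxdx 2 4 5 u v w

/-- The Gram matrix of the 2-form `phi0 u · ·` obtained by contracting `φ₀` with `u`. -/
def contraction (u : Fin 7 → ℝ) : Matrix (Fin 7) (Fin 7) ℝ :=
  !![0, u 2, -u 1, u 4, -u 3, u 6, -u 5;
    -u 2, 0, u 0, u 5, -u 6, -u 3, u 4;
    u 1, -u 0, 0, -u 6, -u 5, u 4, u 3;
    -u 4, -u 5, u 6, 0, u 0, u 1, -u 2;
    u 3, u 6, u 5, -u 0, 0, -u 2, -u 1;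
    -u 6, u 3, -u 4, -u 1, u 2, 0, u 0;
    u 5, -u 4, -u 3, u 2, u 1, -u 0, 0]

open Matrix

lemma phi0_eq_dotProduct (u v w : Fin 7 → ℝ) :
    phi0 u v w = v ⬝ᵥ contraction u *ᵥ w := by
  simp only [phi0, dxdxdx, det_fin_three, contraction, dotProduct, mulVec, Fin.sum_univ_seven]
  simp
  ring

lemma contraction_transpose (u : Fin 7 → ℝ) : (contraction u)ᵀ = -contraction u := by
  ext i j
  fin_cases i <;> fin_cases j <;> simp [contraction]

lemma contraction_mulVec_self (u : Fin 7 → ℝ) : contraction u *ᵥ u = 0 := by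
  ext i
  fin_cases i <;> simp [contraction, mulVec, dotProduct, Fin.sum_univ_seven] <;> ring

lemma vecMul_contraction_self (u : Fin 7 → ℝ) : u ᵥ* contraction u = 0 := by
  rw [← mulVec_transpose, contraction_transpose, neg_mulVec, contraction_mulVec_self, neg_zero]

lemma contraction_mul_self (u : Fin 7 → ℝ) :
    contraction u * contraction u = vecMulVec u u - (u ⬝ᵥ u) • 1 := by
  ext i j
  fin_cases i <;> fin_cases j <;>
    simp [contraction, mul_apply, vecMulVec, dotProduct, Fin.sum_univ_seven, one_apply] <;> ring

lemma det_one_add_vecMulVec (u v : Fin 7 → ℝ) : (1 + vecMulVec u v).det = 1 + v ⬝ᵥ u := by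
  rw [vecMulVec_eq Unit, det_one_add_replicateCol_mul_replicateRow]

lemma det_smul_one_add_vecMulVec (a b : ℝ) (ha : a ≠ 0) (u : Fin 7 → ℝ) :
    (a • (1 : Matrix (Fin 7) (Fin 7) ℝ) + b • vecMulVec u u).det
      = a ^ 6 * (a + b * (u ⬝ᵥ u)) := by
  have h : a • (1 : Matrix (Fin 7) (Fin 7) ℝ) + b • vecMulVec u u
      = a • (1 + vecMulVec ((b / a) • u) u) := by
    rw [smul_add, smul_vecMulVec, smul_smul, mul_div_cancel₀ _ ha]
  rw [h, det_smul, det_one_add_vecMulVec, dotProduct_smul, smul_eq_mul, Fintype.card_fin]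
  field_simp

lemma det_contraction_add_self_sq {u : Fin 7 → ℝ} (hu : u ⬝ᵥ u ≠ 0) :
    (contraction u + vecMulVec u u).det ^ 2 = (u ⬝ᵥ u) ^ 8 := by
  have h : (contraction u + vecMulVec u u) * (contraction u + vecMulVec u u)ᵀ
      = (u ⬝ᵥ u) • (1 : Matrix (Fin 7) (Fin 7) ℝ) + (u ⬝ᵥ u - 1) • vecMulVec u u := by
    rw [transpose_add, contraction_transpose, transpose_vecMulVec, add_mul, mul_add, mul_add,
      mul_neg, mul_neg, contraction_mul_self, mul_vecMulVec, contraction_mulVec_self,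
      vecMulVec_mul, vecMul_contraction_self, vecMulVec_mul_vecMulVec]
    simp only [zero_vecMulVec, vecMulVec_zero, sub_smul, one_smul, vecMulVec_smul]
    abel
  have h' := congrArg det h
  rw [det_mul, det_transpose, det_smul_one_add_vecMulVec _ _ hu] at h'
  rw [sq, h']
  ring

lemma det_contraction_add_sq {u : Fin 7 → ℝ} (hu : u ⬝ᵥ u ≠ 0) (w : Fin 7 → ℝ) :
    (contraction u + vecMulVec w w).det ^ 2 = (u ⬝ᵥ w) ^ 4 * (u ⬝ᵥ u) ^ 4 := by
  set z : Fin 7 → ℝ := (u ⬝ᵥ u)⁻¹ • (w - u) with hz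
  have hw : u ᵥ* (1 + vecMulVec u z) = w := by
    rw [vecMul_add, vecMul_one, vecMul_vecMulVec, hz, smul_smul, mul_inv_cancel₀ hu, one_smul,
      add_sub_cancel]
  have hM : (1 + vecMulVec u z)ᵀ * contraction u * (1 + vecMulVec u z) = contraction u := by
    rw [transpose_add, transpose_one, transpose_vecMulVec, add_mul, one_mul, vecMulVec_mul,
      vecMul_contraction_self, vecMulVec_zero, add_zero, mul_add, mul_one, mul_vecMulVec,
      contraction_mulVec_self, zero_vecMulVec, add_zero]
  have h : contraction u + vecMulVec w w
      = (1 + vecMulVec u z)ᵀ * (contraction u + vecMulVec u u) * (1 + vecMulVec u z) := by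
    rw [Matrix.mul_add (1 + vecMulVec u z)ᵀ, add_mul (_ * contraction u), hM, mul_vecMulVec, vecMulVec_mul, mulVec_transpose, hw]
  rw [h, det_mul, det_mul, det_transpose, det_one_add_vecMulVec, mul_pow, mul_pow,
    det_contraction_add_self_sq hu, hz, smul_dotProduct, sub_dotProduct, dotProduct_comm w u,
    smul_eq_mul]
  field_simp
  ring

lemma transpose_mul_contraction_mul {B : Matrix (Fin 7) (Fin 7) ℝ}
    (hB : ∀ u v w, phi0 (B *ᵥ u) (B *ᵥ v) (B *ᵥ w) = phi0 u v w) (u : Fin 7 → ℝ) :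
    Bᵀ * contraction (B *ᵥ u) * B = contraction u := by
  refine ext_of_mulVec_single fun j => dotProduct_eq _ _ fun v => ?_
  rw [dotProduct_comm, dotProduct_comm _ v, ← phi0_eq_dotProduct, ← hB, phi0_eq_dotProduct,
    ← mulVec_mulVec, ← mulVec_mulVec, dotProduct_mulVec, vecMul_transpose]

lemma det_pow_mul_normSq_pow {B : Matrix (Fin 7) (Fin 7) ℝ}
    (hB : ∀ u v w, phi0 (B *ᵥ u) (B *ᵥ v) (B *ᵥ w) = phi0 u v w) {u : Fin 7 → ℝ}
    (hu : u ⬝ᵥ u ≠ 0) (hBu : (B *ᵥ u) ⬝ᵥ (B *ᵥ u) ≠ 0) :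
    B.det ^ 4 * ((B *ᵥ u) ⬝ᵥ (B *ᵥ u)) ^ 4 = (u ⬝ᵥ u) ^ 4 := by
  have h : Bᵀ * (contraction (B *ᵥ u) + vecMulVec (B *ᵥ u) (B *ᵥ u)) * B
      = contraction u + vecMulVec (Bᵀ *ᵥ (B *ᵥ u)) (Bᵀ *ᵥ (B *ᵥ u)) := by
    rw [mul_add, add_mul, transpose_mul_contraction_mul hB, mul_vecMulVec, vecMulVec_mul,
      ← mulVec_transpose]
  have h' := congrArg (fun N => N.det ^ 2) h
  simp only [det_mul, det_transpose, mul_pow] at h'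
  rw [det_contraction_add_sq hBu, det_contraction_add_sq hu, dotProduct_mulVec u,
    vecMul_transpose] at h'
  refine mul_left_cancel₀ (pow_ne_zero 4 hBu) ?_
  linear_combination h'

lemma transpose_mul_self_eq_one {B : Matrix (Fin 7) (Fin 7) ℝ} (hdet : B.det ≠ 0)
    (hB : ∀ u v w, phi0 (B *ᵥ u) (B *ᵥ v) (B *ᵥ w) = phi0 u v w) : Bᵀ * B = 1 := by
  have hnorm (u : Fin 7 → ℝ) : (B *ᵥ u) ⬝ᵥ (B *ᵥ u) = |B.det|⁻¹ * (u ⬝ᵥ u) := by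
    rcases eq_or_ne u 0 with rfl | hu
    · simp
    have hBu : B *ᵥ u ≠ 0 := fun h => hu (eq_zero_of_mulVec_eq_zero hdet h)
    have h := det_pow_mul_normSq_pow hB (dotProduct_self_eq_zero.not.2 hu)
      (dotProduct_self_eq_zero.not.2 hBu)
    rw [← Even.pow_abs (by decide : Even 4) B.det, ← mul_pow] at h
    have hnn (x : Fin 7 → ℝ) : 0 ≤ x ⬝ᵥ x := Finset.sum_nonneg fun i _ => mul_self_nonneg (x i)
    rw [← (pow_left_inj₀ (mul_nonneg (abs_nonneg _) (hnn _)) (hnn _) four_ne_zero).1 h,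
      inv_mul_cancel_left₀ (abs_ne_zero.2 hdet)]
  have hpolar (u v : Fin 7 → ℝ) : (B *ᵥ u) ⬝ᵥ (B *ᵥ v) = |B.det|⁻¹ * (u ⬝ᵥ v) := by
    have h := hnorm (u + v)
    simp only [mulVec_add, add_dotProduct, dotProduct_add, hnorm,
      dotProduct_comm (B *ᵥ v) (B *ᵥ u), dotProduct_comm v u] at h
    linear_combination h / 2
  have hgram : Bᵀ * B = |B.det|⁻¹ • (1 : Matrix (Fin 7) (Fin 7) ℝ) := by
    refine ext_of_mulVec_single fun j => dotProduct_eq _ _ fun v => ?_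
    rw [dotProduct_comm, ← mulVec_mulVec, dotProduct_mulVec, vecMul_transpose, hpolar, smul_mulVec,
      one_mulVec, smul_dotProduct, smul_eq_mul, dotProduct_comm v]
  have hd := congrArg det hgram
  rw [det_mul, det_transpose, det_smul, det_one, mul_one, Fintype.card_fin, ← abs_mul_abs_self,
    inv_pow, ← mul_eq_one_iff_eq_inv₀ (pow_ne_zero 7 (abs_ne_zero.2 hdet))] at hd
  have hone : |B.det| = 1 :=
    (pow_eq_one_iff_of_nonneg (abs_nonneg _) (n := 9) (by norm_num)).1 (by linear_combination hd)
  rw [hgram, hone, inv_one, one_smul]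


/-- Every linear automorphism of `ℝ⁷` preserving `φ₀` is orthogonal. -/
theorem g2_preserves_inner (A : (Fin 7 → ℝ) ≃ₗ[ℝ] (Fin 7 → ℝ))
    (hA : ∀ u v w : Fin 7 → ℝ, phi0 (A u) (A v) (A w) = phi0 u v w) :
    ∀ u v : Fin 7 → ℝ, ∑ i, A u i * A v i = ∑ i, u i * v i := by
  intro u v
  set B := LinearMap.toMatrix' (A : (Fin 7 → ℝ) →ₗ[ℝ] (Fin 7 → ℝ)) with hBdef
  have hA' (x : Fin 7 → ℝ) : A x = B *ᵥ x := by
    rw [hBdef, LinearMap.toMatrix'_mulVec]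
    rfl
  have hdet : B.det ≠ 0 := by
    rw [hBdef, LinearMap.det_toMatrix']
    exact (LinearEquiv.isUnit_det' A).ne_zero
  have hB := transpose_mul_self_eq_one hdet fun u v w => by simpa only [hA'] using hA u v w
  change A u ⬝ᵥ A v = u ⬝ᵥ v
  rw [hA', hA', dotProduct_mulVec, ← mulVec_transpose, mulVec_mulVec, hB, one_mulVec]
end

section
/- Every linear automorphism of ℝ⁷ preserving the standard G₂ 3-form φ₀ has determinant 1: if A : ℝ⁷ → ℝ⁷ is a linear equivalence such that φ₀(Au, Av, Aw) = φ₀(u, v, w) for all u, v, w ∈ ℝ⁷, then det A = 1. (Together with orthogonality this gives the paper's assertion G₂ ⊂ SO(7), so that a G₂-structure naturally defines an orientation.) -/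
/-- The Pfaffian of the `6 × 6` skew submatrix of `M` on the rows and columns `a, …, f`. -/
def pfaffianSix (M : Matrix (Fin 7) (Fin 7) ℝ) (a b c d e f : Fin 7) : ℝ :=
  M a b * (M c d * M e f - M c e * M d f + M c f * M d e)
    - M a c * (M b d * M e f - M b e * M d f + M b f * M d e)
    + M a d * (M b c * M e f - M b e * M c f + M b f * M c e)
    - M a e * (M b c * M d f - M b d * M c f + M b f * M c d)
    + M a f * (M b c * M d e - M b d * M c e + M b e * M c d)

/-- The vector of signed sub-Pfaffians of a skew `7 × 7` matrix, which spans its kernel when the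
matrix has rank `6`. -/
def pfaffianVec (M : Matrix (Fin 7) (Fin 7) ℝ) : Fin 7 → ℝ :=
  ![pfaffianSix M 1 2 3 4 5 6, -pfaffianSix M 0 2 3 4 5 6, pfaffianSix M 0 1 3 4 5 6,
    -pfaffianSix M 0 1 2 4 5 6, pfaffianSix M 0 1 2 3 5 6, -pfaffianSix M 0 1 2 3 4 6,
    pfaffianSix M 0 1 2 3 4 5]

open Matrix in
lemma transvection_congr_apply (M : Matrix (Fin 7) (Fin 7) ℝ) (hM : Mᵀ = -M) (i j : Fin 7)
    (c : ℝ) (a b : Fin 7) :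
    ((transvection i j c)ᵀ * M * transvection i j c) a b =
      M a b + (if b = j then c * M a i else 0) + (if a = j then c * M i b else 0) := by
  have hii : M i i = 0 := by
    have := congrFun (congrFun hM i) i
    simp only [transpose_apply, Matrix.neg_apply] at this
    linarith
  have h1 : ∀ k l, (M * transvection i j c) k l = M k l + if l = j then c * M k i else 0 := by
    intro k l
    split_ifs with h
    · subst h; simp
    · simp [h]
  rw [Matrix.mul_assoc]
  have h2 : ∀ N : Matrix (Fin 7) (Fin 7) ℝ, ((transvection i j c)ᵀ * N) a b =
      N a b + if a = j then c * N i b else 0 := by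
    intro N
    have : (transvection i j c)ᵀ = transvection j i c := by
      simp [transvection, transpose_single]
    rw [this]
    split_ifs with h
    · subst h; simp
    · simp [h]
  rw [h2, h1, h1, hii]
  simp

open Matrix in
lemma transvection_mulVec_apply (i j : Fin 7) (c : ℝ) (v : Fin 7 → ℝ) (a : Fin 7) :
    (transvection i j c *ᵥ v) a = v a + if a = i then c * v j else 0 := by
  simp [transvection, add_mulVec, Matrix.single_mulVec, Function.update_apply]

open Matrix in
/-- `A` transforms Pfaffian vectors of skew matrices by its determinant. -/
def PfaffianEquivariant (A : Matrix (Fin 7) (Fin 7) ℝ) : Prop :=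
  ∀ M : Matrix (Fin 7) (Fin 7) ℝ, Mᵀ = -M →
    A *ᵥ pfaffianVec (Aᵀ * M * A) = A.det • pfaffianVec M

open Matrix in
lemma PfaffianEquivariant.mul {A B : Matrix (Fin 7) (Fin 7) ℝ} (hA : PfaffianEquivariant A)
    (hB : PfaffianEquivariant B) : PfaffianEquivariant (A * B) := by
  intro M hM
  have hM' : (Aᵀ * M * A)ᵀ = -(Aᵀ * M * A) := by
    simp [transpose_mul, hM, Matrix.mul_assoc]
  have h : (A * B)ᵀ * M * (A * B) = Bᵀ * (Aᵀ * M * A) * B := by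
    simp only [transpose_mul, Matrix.mul_assoc]
  rw [h, ← mulVec_mulVec, hB _ hM', mulVec_smul, hA M hM, smul_smul, det_mul, mul_comm]

open Matrix in
set_option maxHeartbeats 1000000 in
lemma pfaffianEquivariant_transvection_succ (i : Fin 7) (c : ℝ) :
    PfaffianEquivariant (transvection i (i + 1) c) := by
  intro M hM
  rw [det_transvection_of_ne _ _ (by simp), one_smul]
  have skew : ∀ a b, M a b = -M b a := fun a b ↦ by
    simpa using congrFun (congrFun hM b) a
  have diag : ∀ a, M a a = 0 := fun a ↦ by linarith [skew a a]
  have lower : ∀ a b, b < a → M a b = -M b a := fun a b _ ↦ skew a b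
  ext a
  rw [transvection_mulVec_apply]
  simp only [pfaffianVec, pfaffianSix, transvection_congr_apply M hM]
  fin_cases i <;> fin_cases a <;> simp [diag, lower] <;> ring

open Matrix in
lemma transvection_commutator {n R : Type*} [Fintype n] [DecidableEq n] [CommRing R]
    {i j k : n} (hij : i ≠ j) (hik : i ≠ k) (hkj : k ≠ j) (c : R) :
    transvection i k c * transvection k j 1 * transvection i k (-c) * transvection k j (-1) =
      transvection i j c := by
  have neg (a b : n) (x : R) : single a b (-x) = -single a b x :=
    map_neg (singleAddMonoidHom a b) x
  simp only [transvection, mul_add, add_mul, mul_one, one_mul, single_mul_single_same,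
    single_mul_single_of_ne _ _ _ _ hik.symm, single_mul_single_of_ne _ _ _ _ hij.symm,
    single_mul_single_of_ne _ _ _ _ hkj.symm, zero_mul,
    mul_neg, neg_mul, neg]
  abel

open Matrix in
lemma pfaffianEquivariant_transvection_add (i : Fin 7) (k : ℕ) (hk : k < 6) (c : ℝ) :
    PfaffianEquivariant (transvection i (i + (k + 1) • 1) c) := by
  induction k generalizing c with
  | zero => simpa using pfaffianEquivariant_transvection_succ i c
  | succ k ih =>
    have ne_add : ∀ m : ℕ, m < 6 → i ≠ i + (m + 1) • (1 : Fin 7) := by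
      intro m hm
      clear ih
      interval_cases m <;> revert i <;> decide
    have hj : i + (k + 1 + 1) • (1 : Fin 7) = i + (k + 1) • (1 : Fin 7) + 1 := by
      rw [succ_nsmul, add_assoc]
    have hij := ne_add (k + 1) hk
    rw [hj] at hij ⊢
    rw [← transvection_commutator hij (ne_add k (by lia)) (by simp)]
    exact (((ih (by lia) c).mul (pfaffianEquivariant_transvection_succ _ _)).mul
      (ih (by lia) (-c))).mul (pfaffianEquivariant_transvection_succ _ _)

open Matrix in
lemma pfaffianEquivariant_transvection {i j : Fin 7} (hij : i ≠ j) (c : ℝ) :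
    PfaffianEquivariant (transvection i j c) := by
  obtain ⟨k, hk, rfl⟩ : ∃ k < 6, j = i + (k + 1) • (1 : Fin 7) := by
    revert i j; decide
  exact pfaffianEquivariant_transvection_add i k hk c

open Matrix in
lemma pfaffianEquivariant_diagonal (D : Fin 7 → ℝ) : PfaffianEquivariant (diagonal D) := by
  intro M _
  ext a
  simp only [mulVec_diagonal, det_diagonal, Fin.prod_univ_seven, pfaffianVec, pfaffianSix,
    diagonal_transpose, mul_diagonal, diagonal_mul, Pi.smul_apply, smul_eq_mul]
  fin_cases a <;> simp <;> ring

open Matrix in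
lemma pfaffianEquivariant_of_det_ne_zero (A : Matrix (Fin 7) (Fin 7) ℝ) (hA : A.det ≠ 0) :
    PfaffianEquivariant A :=
  diagonal_transvection_induction_of_det_ne_zero PfaffianEquivariant A hA
    (fun D _ ↦ pfaffianEquivariant_diagonal D)
    (fun t ↦ pfaffianEquivariant_transvection t.hij t.c)
    (fun _ _ _ _ hA hB ↦ hA.mul hB)

/-- The matrix of the 2-form `ι_x φ₀`. -/
def contractPhi0 (x : Fin 7 → ℝ) : Matrix (Fin 7) (Fin 7) ℝ :=
  !![0, x 2, -x 1, x 4, -x 3, x 6, -x 5;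
    -x 2, 0, x 0, x 5, -x 6, -x 3, x 4;
    x 1, -x 0, 0, -x 6, -x 5, x 4, x 3;
    -x 4, -x 5, x 6, 0, x 0, x 1, -x 2;
    x 3, x 6, x 5, -x 0, 0, -x 2, -x 1;
    -x 6, x 3, -x 4, -x 1, x 2, 0, x 0;
    x 5, -x 4, -x 3, x 2, x 1, -x 0, 0]

open Matrix in
lemma contractPhi0_transpose (x : Fin 7 → ℝ) : (contractPhi0 x)ᵀ = -contractPhi0 x := by
  ext a b
  fin_cases a <;> fin_cases b <;> simp [contractPhi0]

open Matrix in
lemma dotProduct_contractPhi0_mulVec (x u v : Fin 7 → ℝ) :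
    u ⬝ᵥ contractPhi0 x *ᵥ v = phi0 x u v := by
  simp [contractPhi0, phi0, dxdxdx, det_fin_three, dotProduct, mulVec, Fin.sum_univ_seven]
  ring

open Matrix in
lemma pfaffianVec_contractPhi0 (x : Fin 7 → ℝ) :
    pfaffianVec (contractPhi0 x) = (x ⬝ᵥ x) • x := by
  ext a
  fin_cases a <;>
    simp [pfaffianVec, pfaffianSix, contractPhi0, dotProduct, Fin.sum_univ_seven] <;> ring

open Matrix in
lemma eq_one_of_dotProduct_self_eq (A : Matrix (Fin 7) (Fin 7) ℝ)
    (h : ∀ x, x ⬝ᵥ x = A.det * ((A *ᵥ x) ⬝ᵥ (A *ᵥ x))) : A.det = 1 := by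
  have polar : ∀ x y, x ⬝ᵥ y = A.det * ((A *ᵥ x) ⬝ᵥ (A *ᵥ y)) := by
    intro x y
    have hxy := h (x + y)
    simp only [mulVec_add, dotProduct_add, add_dotProduct] at hxy
    rw [dotProduct_comm y x, dotProduct_comm (A *ᵥ y)] at hxy
    linarith [h x, h y]
  have hmat : A.det • (Aᵀ * A) = 1 := by
    ext a b
    have := polar (Pi.single a 1) (Pi.single b 1)
    simp only [mulVec_single_one, single_dotProduct, one_mul] at this
    rw [Matrix.smul_apply, smul_eq_mul, mul_apply, one_apply]
    simpa [dotProduct, Pi.single_apply] using this.symm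
  have hpow : A.det ^ 9 = 1 := by
    have := congrArg det hmat
    simp only [det_smul, det_mul, det_transpose, det_one, Fintype.card_fin] at this
    linarith
  exact (Odd.strictMono_pow (by decide : Odd 9)).injective (by simpa using hpow)

open Matrix in
/-- Every linear automorphism of `ℝ⁷` preserving `φ₀` has determinant `1`. -/
theorem g2_det_eq_one (A : (Fin 7 → ℝ) ≃ₗ[ℝ] (Fin 7 → ℝ))
    (hA : ∀ u v w : Fin 7 → ℝ, phi0 (A u) (A v) (A w) = phi0 u v w) :
    LinearMap.det (A : (Fin 7 → ℝ) →ₗ[ℝ] (Fin 7 → ℝ)) = 1 := by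
  set B := LinearMap.toMatrix' (A : (Fin 7 → ℝ) →ₗ[ℝ] (Fin 7 → ℝ)) with hB
  have hBA : ∀ x, B *ᵥ x = A x := fun x ↦ by simp [hB, LinearMap.toMatrix'_mulVec]
  have hdet : LinearMap.det (A : (Fin 7 → ℝ) →ₗ[ℝ] (Fin 7 → ℝ)) = B.det :=
    (LinearMap.det_toMatrix' _).symm
  have hne : B.det ≠ 0 := hdet ▸ (LinearEquiv.isUnit_det' A).ne_zero
  have hcongr : ∀ x, Bᵀ * contractPhi0 (A x) * B = contractPhi0 x := by
    intro x
    refine ext_of_mulVec_single fun b ↦ dotProduct_eq _ _ fun u ↦ ?_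
    rw [dotProduct_comm, dotProduct_comm _ u, dotProduct_contractPhi0_mulVec, ← hA,
      ← dotProduct_contractPhi0_mulVec, ← hBA u, ← hBA (Pi.single b 1), ← mulVec_mulVec,
      ← mulVec_mulVec, dotProduct_mulVec, vecMul_transpose]
  rw [hdet]
  refine eq_one_of_dotProduct_self_eq B fun x ↦ ?_
  have key := pfaffianEquivariant_of_det_ne_zero B hne _ (contractPhi0_transpose (A x))
  rw [hcongr, pfaffianVec_contractPhi0, pfaffianVec_contractPhi0, mulVec_smul, hBA,
    smul_smul] at key
  rw [hBA]
  rcases eq_or_ne x 0 with rfl | hx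
  · simp
  · exact smul_left_injective ℝ (A.map_ne_zero_iff.mpr hx) key
end

section
/- The standard G₂ 3-form φ₀ is a stable form: its GL(7, ℝ)-orbit, namely the set {φ ∈ Λ³(ℝ⁷)* : there exists a linear equivalence A of ℝ⁷ with φ(u,v,w) = φ₀(Au, Av, Aw) for all u, v, w ∈ ℝ⁷}, is an open subset of the finite-dimensional real vector space Λ³(ℝ⁷)* of alternating trilinear forms on ℝ⁷ (with its canonical topology). -/
open Matrix Filter Topology

/-- Alternating maps agree if they agree on strictly increasing families of basis vectors. -/
theorem Module.Basis.ext_alternating_strictMono {R M N κ : Type*} [CommRing R] [AddCommGroup M]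
    [Module R M] [AddCommGroup N] [Module R N] [LinearOrder κ] {n : ℕ}
    (b : Module.Basis κ R M) {f g : M [⋀^Fin n]→ₗ[R] N}
    (h : ∀ v : Fin n → κ, StrictMono v → (f fun i => b (v i)) = g fun i => b (v i)) : f = g := by
  refine b.ext_alternating fun v hv => ?_
  have hs : StrictMono (v ∘ Tuple.sort v) :=
    (Tuple.monotone_sort v).strictMono_of_injective (hv.comp (Tuple.sort v).injective)
  have key := h _ hs
  have hf := f.map_perm (fun i => b (v i)) (Tuple.sort v)
  have hg := g.map_perm (fun i => b (v i)) (Tuple.sort v)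
  simp only [Function.comp_def] at key hf hg
  rw [hf, hg] at key
  exact MulAction.injective _ key

/-- The form `dx^i ∧ dx^j ∧ dx^k` as a continuous alternating map. -/
noncomputable def dxForm (i j k : Fin 7) : (Fin 7 → ℝ) [⋀^Fin 3]→L[ℝ] ℝ :=
  { (detRowAlternating (R := ℝ) (n := Fin 3)).compLinearMap (LinearMap.funLeft ℝ ℝ ![i, j, k]) with
    cont := by
      change Continuous fun v : Fin 3 → Fin 7 → ℝ =>
        Matrix.det (of fun a b => v a (![i, j, k] b))
      fun_prop }

theorem dxForm_apply (i j k : Fin 7) (v : Fin 3 → Fin 7 → ℝ) :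
    dxForm i j k v = dxdxdx i j k (v 0) (v 1) (v 2) := by
  change Matrix.det (of fun a b => v a (![i, j, k] b)) = _
  rw [dxdxdx, det_fin_three, det_fin_three]
  rfl

/-- The `G₂` form `φ₀` as a continuous alternating map. -/
noncomputable def phi0Form : (Fin 7 → ℝ) [⋀^Fin 3]→L[ℝ] ℝ :=
  dxForm 0 1 2 + dxForm 0 3 4 + dxForm 0 5 6 + dxForm 1 3 5
    - dxForm 1 4 6 - dxForm 2 3 6 - dxForm 2 4 5

theorem phi0Form_apply (v : Fin 3 → Fin 7 → ℝ) : phi0Form v = phi0 (v 0) (v 1) (v 2) := by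
  simp [phi0Form, phi0, dxForm_apply]

/-- A matrix `B` whose infinitesimal action on `φ₀` is the `3`-form with coefficients `c`. -/
noncomputable def phi0RightInverse (c : Fin 7 → Fin 7 → Fin 7 → ℝ) : Matrix (Fin 7) (Fin 7) ℝ :=
  !![(2 * c 0 1 2 + 2 * c 0 3 4 + 2 * c 0 5 6 - c 1 3 5 + c 1 4 6 + c 2 3 6 + c 2 4 5) / 6,
     c 1 3 4,
     c 2 3 4,
     c 1 2 3,
     c 1 2 4,
     (c 0 1 3 - c 0 2 4 + c 1 2 5 + c 3 4 5) / 2,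
     (-c 0 1 4 - c 0 2 3 + c 1 2 6 + c 3 4 6) / 2;
     (c 0 3 5 - c 0 4 6 - c 1 3 4 + c 1 5 6) / 2,
     (2 * c 0 1 2 - c 0 3 4 - c 0 5 6 + 2 * c 1 3 5 - 2 * c 1 4 6 + c 2 3 6 + c 2 4 5) / 6,
     c 2 3 5,
     -c 0 2 3,
     (-c 0 1 3 - c 0 2 4 + c 1 2 5 - c 3 4 5) / 2,
     (c 0 1 6 - c 0 2 5 - c 1 2 4 + c 4 5 6) / 2,
     (-c 0 1 5 - c 0 2 6 - c 1 2 3 + c 3 5 6) / 2;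
     (-c 0 3 6 - c 0 4 5 - c 2 3 4 + c 2 5 6) / 2,
     (-c 1 3 6 - c 1 4 5 - c 2 3 5 - c 2 4 6) / 2,
     (2 * c 0 1 2 - c 0 3 4 - c 0 5 6 - c 1 3 5 + c 1 4 6 - 2 * c 2 3 6 - 2 * c 2 4 5) / 6,
     c 0 1 3,
     (c 0 1 4 - c 0 2 3 - c 1 2 6 + c 3 4 6) / 2,
     (c 0 1 5 + c 0 2 6 - c 1 2 3 + c 3 5 6) / 2,
     (c 0 1 6 - c 0 2 5 + c 1 2 4 - c 4 5 6) / 2;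
     (-c 0 1 5 + c 0 2 6 - c 1 2 3 + c 3 5 6) / 2,
     (c 0 1 4 + c 0 2 3 + c 1 2 6 - c 3 4 6) / 2,
     (-c 0 1 3 + c 0 2 4 + c 1 2 5 - c 3 4 5) / 2,
     (-c 0 1 2 + 2 * c 0 3 4 - c 0 5 6 + 2 * c 1 3 5 + c 1 4 6 - 2 * c 2 3 6 + c 2 4 5) / 6,
     (-c 1 3 6 + c 1 4 5 - c 2 3 5 - c 2 4 6) / 2,
     (c 0 3 6 - c 0 4 5 + c 2 3 4 - c 2 5 6) / 2,
     (-c 0 3 5 - c 0 4 6 + c 1 3 4 - c 1 5 6) / 2;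
     (c 0 1 6 + c 0 2 5 - c 1 2 4 + c 4 5 6) / 2,
     0,
     0,
     0,
     (-c 0 1 2 + 2 * c 0 3 4 - c 0 5 6 - c 1 3 5 - 2 * c 1 4 6 + c 2 3 6 - 2 * c 2 4 5) / 6,
     (c 0 3 5 + c 0 4 6 + c 1 3 4 - c 1 5 6) / 2,
     (c 0 3 6 - c 0 4 5 - c 2 3 4 + c 2 5 6) / 2;
     0,
     0,
     0,
     0,
     0,
     (-c 0 1 2 - c 0 3 4 + 2 * c 0 5 6 + 2 * c 1 3 5 + c 1 4 6 + c 2 3 6 - 2 * c 2 4 5) / 6,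
     (c 1 3 6 - c 1 4 5 - c 2 3 5 - c 2 4 6) / 2;
     0,
     0,
     0,
     0,
     0,
     0,
     (-c 0 1 2 - c 0 3 4 + 2 * c 0 5 6 - c 1 3 5 - 2 * c 1 4 6 - 2 * c 2 3 6 + c 2 4 5) / 6]

set_option maxHeartbeats 1000000 in
/-- The infinitesimal action of `phi0RightInverse c` on `φ₀` has coefficients `c i j k`. -/
theorem phi0_rightInverse (c : Fin 7 → Fin 7 → Fin 7 → ℝ) {i j k : Fin 7} (hij : i < j)
    (hjk : j < k) :
    phi0 ((phi0RightInverse c).col i) (Pi.single j 1) (Pi.single k 1)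
      + phi0 (Pi.single i 1) ((phi0RightInverse c).col j) (Pi.single k 1)
      + phi0 (Pi.single i 1) (Pi.single j 1) ((phi0RightInverse c).col k) = c i j k := by
  fin_cases i <;> fin_cases j <;> first | (exfalso; revert hij; decide) | skip
  all_goals fin_cases k <;> first | (exfalso; revert hjk; decide) | skip
  all_goals
    simp [phi0, dxdxdx, det_fin_three, phi0RightInverse]
    try ring

/-- The derivative at the identity of `A ↦ A^* φ₀` is onto. -/
theorem range_fderiv_phi0Form :
    (phi0Form.fderivCompContinuousLinearMap
      (ContinuousLinearMap.id ℝ (Fin 7 → ℝ))).range = ⊤ := by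
  refine LinearMap.range_eq_top.2 fun ψ => ?_
  let e : Module.Basis (Fin 7) ℝ (Fin 7 → ℝ) := Pi.basisFun ℝ (Fin 7)
  let B := phi0RightInverse fun i j k => ψ ![e i, e j, e k]
  refine ⟨LinearMap.toContinuousLinearMap (Matrix.toLin' B), ?_⟩
  refine ContinuousAlternatingMap.toAlternatingMap_injective
    (e.ext_alternating_strictMono fun v hv => ?_)
  have h := phi0_rightInverse (fun i j k => ψ ![e i, e j, e k])
    (hv (show (0 : Fin 3) < 1 by decide)) (hv (show (1 : Fin 3) < 2 by decide))
  have hψ : ![e (v 0), e (v 1), e (v 2)] = fun i => e (v i) := by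
    ext i : 1
    fin_cases i <;> rfl
  simp only [hψ] at h
  refine Eq.trans ?_ h
  simp [Fin.sum_univ_three, phi0Form_apply, e, B, Function.update]

/-- The orbit of `φ₀` under linear isomorphisms is a neighbourhood of `φ₀`. -/
theorem pullback_phi0Form_mem_nhds :
    {φ | ∃ A : (Fin 7 → ℝ) ≃L[ℝ] (Fin 7 → ℝ), phi0Form.compContinuousLinearMap A = φ}
      ∈ 𝓝 phi0Form := by
  have hd : HasStrictFDerivAt
      (fun A : (Fin 7 → ℝ) →L[ℝ] (Fin 7 → ℝ) => phi0Form.compContinuousLinearMap A)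
      (phi0Form.fderivCompContinuousLinearMap (.id ℝ _)) (.id ℝ _) := by
    simpa using (hasStrictFDerivAt_const phi0Form _).continuousAlternatingMapCompContinuousLinearMap
      (hasStrictFDerivAt_id (𝕜 := ℝ) (ContinuousLinearMap.id ℝ (Fin 7 → ℝ)))
  have h := hd.map_nhds_eq_of_surj range_fderiv_phi0Form
  rw [show phi0Form.compContinuousLinearMap (.id ℝ _) = phi0Form from rfl] at h
  rw [← h, mem_map]
  filter_upwards [ContinuousLinearEquiv.nhds (ContinuousLinearEquiv.refl ℝ (Fin 7 → ℝ))]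
    with A hA
  obtain ⟨A, rfl⟩ := hA
  exact ⟨A, rfl⟩

/-- `φ₀` is a stable form: its `GL(7,ℝ)`-orbit is open in the space `Λ³(ℝ⁷)*` of
alternating trilinear forms on `ℝ⁷` (every alternating multilinear map on a
finite-dimensional space is continuous, so `Λ³(ℝ⁷)*` is modeled by the space of
continuous alternating maps with its canonical topology). -/
theorem g2_form_stable :
    IsOpen {φ : (Fin 7 → ℝ) [⋀^Fin 3]→L[ℝ] ℝ |
      ∃ A : (Fin 7 → ℝ) ≃ₗ[ℝ] (Fin 7 → ℝ),
        ∀ u v w : Fin 7 → ℝ, φ ![u, v, w] = phi0 (A u) (A v) (A w)} := by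
  rw [isOpen_iff_mem_nhds]
  rintro φ ⟨A, hA⟩
  let A' := A.toContinuousLinearEquiv
  let T := ContinuousAlternatingMap.compContinuousLinearMapCLM (𝕜 := ℝ) (F := ℝ) (ι := Fin 3)
    (A'.symm : (Fin 7 → ℝ) →L[ℝ] (Fin 7 → ℝ))
  have hT : T φ = phi0Form := by
    ext v
    have hv : ⇑A'.symm ∘ v = ![A'.symm (v 0), A'.symm (v 1), A'.symm (v 2)] := by
      ext i : 1
      fin_cases i <;> rfl
    change φ (⇑A'.symm ∘ v) = _
    rw [hv, hA, phi0Form_apply]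
    congr 1 <;> exact A'.apply_symm_apply _
  have h : T ⁻¹' _ ∈ 𝓝 φ := T.continuous.continuousAt.preimage_mem_nhds
    (by rw [hT]; exact pullback_phi0Form_mem_nhds)
  filter_upwards [h] with ψ ⟨B, hB⟩
  refine ⟨A.trans B.toLinearEquiv, fun u v w => ?_⟩
  have hψ := DFunLike.congr_fun hB ![A u, A v, A w]
  have hu : ⇑A'.symm ∘ ![A u, A v, A w] = ![u, v, w] := by
    ext i : 1
    fin_cases i <;> exact A'.symm_apply_apply _
  change phi0Form (⇑B ∘ _) = ψ (⇑A'.symm ∘ _) at hψ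
  rw [hu, phi0Form_apply] at hψ
  exact hψ.symm
end

section
/- Infinitesimal stability of φ₀: the linear map from the space of all linear endomorphisms of ℝ⁷ to the space Λ³(ℝ⁷)* of alternating trilinear forms on ℝ⁷, sending an endomorphism B to the alternating 3-form (u, v, w) ↦ φ₀(Bu, v, w) + φ₀(u, Bv, w) + φ₀(u, v, Bw), is surjective. (This is the derivative at the identity of the GL(7, ℝ)-orbit map A ↦ A*φ₀, and is the infinitesimal form of the statement that the orbit of φ₀ is open in Λ³(ℝ⁷)*.) -/
/-- Alternating maps agree as soon as they agree on strictly increasing tuples of basis vectors. -/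
theorem AlternatingMap.ext_basis_strictMono {R M N ι : Type*} [CommRing R] [AddCommGroup M]
    [Module R M] [AddCommGroup N] [Module R N] [LinearOrder ι] [Finite ι] {n : ℕ}
    (e : Module.Basis ι R M) {f g : M [⋀^Fin n]→ₗ[R] N}
    (h : ∀ v : Fin n → ι, StrictMono v → f (fun i => e (v i)) = g (fun i => e (v i))) :
    f = g := by
  refine e.ext_alternating fun v hv => ?_
  have key := h (v ∘ Tuple.sort v)
    ((Tuple.monotone_sort v).strictMono_of_injective (hv.comp (Tuple.sort v).injective))
  have hf := f.map_perm (fun i => e (v i)) (Tuple.sort v)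
  have hg := g.map_perm (fun i => e (v i)) (Tuple.sort v)
  simp only [Function.comp_def] at key hf hg
  rw [hf, hg] at key
  exact MulAction.injective _ key

theorem dxdxdx_apply (i j k : Fin 7) (u v w : Fin 7 → ℝ) :
    dxdxdx i j k u v w = u i * v j * w k - u i * v k * w j - u j * v i * w k
      + u j * v k * w i + u k * v i * w j - u k * v j * w i := by
  simp [dxdxdx, Matrix.det_fin_three]

theorem phi0_add (u u' v w : Fin 7 → ℝ) : phi0 (u + u') v w = phi0 u v w + phi0 u' v w := by
  simp only [phi0, dxdxdx_apply, Pi.add_apply]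
  ring

theorem phi0_smul (r : ℝ) (u v w : Fin 7 → ℝ) : phi0 (r • u) v w = r * phi0 u v w := by
  simp only [phi0, dxdxdx_apply, Pi.smul_apply, smul_eq_mul]
  ring

theorem phi0_swap_left (u v w : Fin 7 → ℝ) : phi0 u v w = -phi0 v u w := by
  simp only [phi0, dxdxdx_apply]
  ring

theorem phi0_rotate (u v w : Fin 7 → ℝ) : phi0 u v w = phi0 v w u := by
  simp only [phi0, dxdxdx_apply]
  ring

theorem phi0_add_mid (u v v' w : Fin 7 → ℝ) : phi0 u (v + v') w = phi0 u v w + phi0 u v' w := by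
  simp only [phi0_rotate u, phi0_add]

theorem phi0_add_right (u v w w' : Fin 7 → ℝ) : phi0 u v (w + w') = phi0 u v w + phi0 u v w' := by
  simp only [phi0_rotate u v, phi0_add_mid]

theorem phi0_smul_mid (r : ℝ) (u v w : Fin 7 → ℝ) : phi0 u (r • v) w = r * phi0 u v w := by
  simp only [phi0_rotate u, phi0_smul]

theorem phi0_smul_right (r : ℝ) (u v w : Fin 7 → ℝ) : phi0 u v (r • w) = r * phi0 u v w := by
  simp only [phi0_rotate u v, phi0_smul_mid]

theorem phi0_self_left (u w : Fin 7 → ℝ) : phi0 u u w = 0 := by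
  linarith [phi0_swap_left u u w]

/-- The infinitesimal action of an endomorphism `B` on `φ₀`, as an alternating form. -/
noncomputable def phi0Deriv (B : (Fin 7 → ℝ) →ₗ[ℝ] (Fin 7 → ℝ)) :
    (Fin 7 → ℝ) [⋀^Fin 3]→ₗ[ℝ] ℝ where
  toFun v := phi0 (B (v 0)) (v 1) (v 2) + phi0 (B (v 1)) (v 2) (v 0) + phi0 (B (v 2)) (v 0) (v 1)
  map_update_add' v i x y := by
    rename_i inst
    cases Subsingleton.elim inst (instDecidableEqFin 3)
    fin_cases i <;> simp [phi0_add, phi0_add_mid, phi0_add_right] <;> ring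
  map_update_smul' v i r x := by
    rename_i inst
    cases Subsingleton.elim inst (instDecidableEqFin 3)
    fin_cases i <;> simp [phi0_smul, phi0_smul_mid, phi0_smul_right] <;> ring
  map_eq_zero_of_eq' v i j h hij := by
    have self : ∀ x y, phi0 x y y = 0 := fun x y => by rw [phi0_rotate, phi0_self_left]
    have swap : ∀ x y, phi0 (B x) y x + phi0 (B x) x y = 0 := fun x y => by
      rw [phi0_rotate _ y, phi0_swap_left y, ← phi0_rotate (B x) x y]
      ring
    have zero : ∀ x y, phi0 (B x) x y + phi0 (B x) y x + phi0 (B y) x x = 0 := fun x y => by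
      rw [self, add_zero, add_comm, swap]
    fin_cases i <;> fin_cases j <;> simp at hij h <;> rw [h]
    all_goals first
      | linarith [zero (v 1) (v 2)]
      | linarith [zero (v 2) (v 1)]
      | linarith [zero (v 2) (v 0)]
      | linarith [zero (v 0) (v 2)]
      | linarith [zero (v 1) (v 0)]
      | linarith [zero (v 0) (v 1)]

/-- The contraction `½ ∑ⱼₖ φ₀(e_l, eⱼ, eₖ) c(i, j, k)` of an array of coefficients with `φ₀`. -/
def phi0Contract (c : Fin 7 → Fin 7 → Fin 7 → ℝ) (l i : Fin 7) : ℝ :=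
  ![c i 1 2 + c i 3 4 + c i 5 6,
    c i 2 0 + c i 3 5 - c i 4 6,
    c i 0 1 - c i 3 6 - c i 4 5,
    c i 4 0 + c i 5 1 - c i 6 2,
    c i 0 3 - c i 6 1 - c i 5 2,
    c i 6 0 + c i 1 3 - c i 2 4,
    c i 0 5 - c i 1 4 - c i 2 3] l

/-- The matrix of a preimage, under `phi0Deriv`, of the 3-form with coefficients `c`. -/
noncomputable def phi0DerivPreimage (c : Fin 7 → Fin 7 → Fin 7 → ℝ) : Matrix (Fin 7) (Fin 7) ℝ :=
  Matrix.of fun l i => phi0Contract c l i / 3 + phi0Contract c i l / 6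
    - if l = i then (∑ m, phi0Contract c m m) / 18 else 0

set_option maxHeartbeats 2000000 in
theorem phi0_phi0DerivPreimage (c : Fin 7 → Fin 7 → Fin 7 → ℝ)
    (h₁ : ∀ i j k, c i j k = -c j i k) (h₂ : ∀ i j k, c i j k = -c i k j)
    {i j k : Fin 7} (hij : i < j) (hjk : j < k) :
    c i j k = phi0 ((phi0DerivPreimage c).col i) (Pi.single j 1) (Pi.single k 1)
      + phi0 ((phi0DerivPreimage c).col j) (Pi.single k 1) (Pi.single i 1)
      + phi0 ((phi0DerivPreimage c).col k) (Pi.single i 1) (Pi.single j 1) := by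
  have s₁ : ∀ i j k, j < i → c i j k = -c j i k := fun i j k _ => h₁ i j k
  have s₂ : ∀ i j k, k < j → c i j k = -c i k j := fun i j k _ => h₂ i j k
  have z₁ : ∀ i k, c i i k = 0 := fun i k => by linarith [h₁ i i k]
  have z₂ : ∀ i k, c i k k = 0 := fun i k => by linarith [h₂ i k k]
  fin_cases i <;> fin_cases j <;> first
    | exact absurd hij (by decide)
    | fin_cases k <;> first
      | exact absurd hjk (by decide)
      | (simp [phi0, dxdxdx_apply]
         simp only [phi0DerivPreimage, Matrix.of_apply, Fin.sum_univ_seven]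
         simp only [phi0Contract]
         dsimp
         simp [z₁, z₂, s₁, s₂]
         ring)

/-- Infinitesimal stability of `φ₀`: every alternating trilinear form on `ℝ⁷` is of the
form `(u,v,w) ↦ φ₀(Bu,v,w) + φ₀(u,Bv,w) + φ₀(u,v,Bw)` for some linear endomorphism `B`
of `ℝ⁷`; i.e. the derivative at the identity of the orbit map `A ↦ A*φ₀` is surjective. -/
theorem g2_form_infinitesimally_stable :
    ∀ ψ : (Fin 7 → ℝ) [⋀^Fin 3]→ₗ[ℝ] ℝ,
      ∃ B : (Fin 7 → ℝ) →ₗ[ℝ] (Fin 7 → ℝ),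
        ∀ u v w : Fin 7 → ℝ,
          ψ ![u, v, w] = phi0 (B u) v w + phi0 u (B v) w + phi0 u v (B w) := by
  intro ψ
  let c : Fin 7 → Fin 7 → Fin 7 → ℝ := fun i j k =>
    ψ ![Pi.single i 1, Pi.single j 1, Pi.single k 1]
  have h₁ : ∀ i j k, c i j k = -c j i k := fun i j k => by
    refine Eq.trans (congrArg ψ ?_) (ψ.map_swap ![Pi.single j 1, Pi.single i 1, Pi.single k 1]
      (show (0 : Fin 3) ≠ 1 by decide))
    ext a : 1
    fin_cases a <;> rfl
  have h₂ : ∀ i j k, c i j k = -c i k j := fun i j k => by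
    refine Eq.trans (congrArg ψ ?_) (ψ.map_swap ![Pi.single i 1, Pi.single k 1, Pi.single j 1]
      (show (1 : Fin 3) ≠ 2 by decide))
    ext a : 1
    fin_cases a <;> rfl
  refine ⟨(phi0DerivPreimage c).mulVecLin, fun u v w => ?_⟩
  suffices h : ψ = phi0Deriv (phi0DerivPreimage c).mulVecLin by
    rw [h, phi0_rotate u, ← phi0_rotate _ u v]
    rfl
  refine AlternatingMap.ext_basis_strictMono (Pi.basisFun ℝ (Fin 7)) fun v hv => ?_
  have key := phi0_phi0DerivPreimage c h₁ h₂ (hv (show (0 : Fin 3) < 1 by decide))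
    (hv (show (1 : Fin 3) < 2 by decide))
  have hψ : (fun i => Pi.basisFun ℝ (Fin 7) (v i)) =
      ![Pi.single (v 0) 1, Pi.single (v 1) 1, Pi.single (v 2) 1] := by
    ext a : 1
    fin_cases a <;> simp
  rw [hψ]
  refine key.trans ?_
  simp [phi0Deriv]
end

section
/- The stabiliser in G₂ of a vector preserves the standard SU(3)-structure on its orthogonal complement: if A : ℝ⁷ → ℝ⁷ is a linear equivalence with φ₀(Au, Av, Aw) = φ₀(u, v, w) for all u, v, w ∈ ℝ⁷ and A e₁ = e₁, then (i) A maps the orthogonal complement of e₁ (the span of e₂,…,e₇) onto itself, (ii) ω₀(Au, Av) = ω₀(u, v) for all u, v ∈ ℝ⁷, and (iii) Ω₀(Au, Av, Aw) = Ω₀(u, v, w) for all u, v, w ∈ ℝ⁷. (This is the pointwise content of the paper's statement that the stabiliser in G₂ of a vector in ℝ⁷ is SU(3).) -/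
/-- The alternating 2-form `dx^i ∧ dx^j` on `ℝ⁷`, evaluated on `u, v`. -/
noncomputable def dxdx (i j : Fin 7) (u v : Fin 7 → ℝ) : ℝ := u i * v j - u j * v i

/-- The standard Kähler 2-form `ω₀ = dx²³ + dx⁴⁵ + dx⁶⁷` (indices shifted to `Fin 7`). -/
noncomputable def omega0 (u v : Fin 7 → ℝ) : ℝ :=
  dxdx 1 2 u v + dxdx 3 4 u v + dxdx 5 6 u v

/-- The real part of the standard holomorphic volume form,
`Ω₀ = dx²⁴⁶ − dx²⁵⁷ − dx³⁴⁷ − dx³⁵⁶` (indices shifted to `Fin 7`). -/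
noncomputable def bigOmega0 (u v w : Fin 7 → ℝ) : ℝ :=
  dxdxdx 1 3 5 u v w - dxdxdx 1 4 6 u v w - dxdxdx 2 3 6 u v w - dxdxdx 2 4 5 u v w

/-- The first standard basis vector `e₁` of `ℝ⁷`. -/
noncomputable def e1 : Fin 7 → ℝ := Pi.single 0 1

theorem phi0_eq (u v w : Fin 7 → ℝ) :
    phi0 u v w = bigOmega0 u v w
      + (u 0 * omega0 v w - v 0 * omega0 u w + w 0 * omega0 u v) := by
  simp only [phi0, bigOmega0, omega0, dxdxdx, dxdx, Matrix.det_fin_three, Matrix.of_apply,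
    Matrix.cons_val', Matrix.cons_val_zero, Matrix.cons_val_one, Matrix.cons_val,
    Matrix.cons_val_fin_one]
  ring

theorem phi0_e1_left (u v : Fin 7 → ℝ) : phi0 e1 u v = omega0 u v := by
  simp [phi0, omega0, dxdxdx, dxdx, e1, Matrix.det_fin_three]

/-- The Gram matrix of `ω₀` on the last six coordinates. -/
def symplecticGram : Matrix (Fin 6) (Fin 6) ℝ :=
  !![0, 1, 0, 0, 0, 0; -1, 0, 0, 0, 0, 0; 0, 0, 0, 1, 0, 0;
     0, 0, -1, 0, 0, 0; 0, 0, 0, 0, 0, 1; 0, 0, 0, 0, -1, 0]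

theorem symplecticGram_mul_self : symplecticGram * symplecticGram = -1 := by
  ext i j
  fin_cases i <;> fin_cases j <;>
    simp [symplecticGram, Matrix.mul_apply, Fin.sum_univ_six]

theorem omega0_single_succ (p q : Fin 6) :
    omega0 (Pi.single p.succ 1) (Pi.single q.succ 1) = symplecticGram p q := by
  fin_cases p <;> fin_cases q <;> simp [omega0, dxdx, symplecticGram]

/-- The bivector dual to `ω₀` is the same in every symplectic basis. -/
theorem mul_symplecticGram_mul_transpose {M : Matrix (Fin 6) (Fin 6) ℝ}
    (h : M.transpose * symplecticGram * M = symplecticGram) :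
    M * symplecticGram * M.transpose = symplecticGram := by
  have hl : -(symplecticGram * M.transpose * symplecticGram) * M = 1 := by
    rw [neg_mul, Matrix.mul_assoc, Matrix.mul_assoc, ← Matrix.mul_assoc M.transpose, h,
      symplecticGram_mul_self, neg_neg]
  have hr := congrArg (· * symplecticGram) (mul_eq_one_comm.mp hl)
  simpa [Matrix.mul_assoc, symplecticGram_mul_self] using hr

/-- `Ω₀` is primitive: its contraction with the bivector dual to `ω₀`, written in any
symplectic basis, vanishes. -/
theorem bigOmega0_contract_eq_zero (a : Fin 6 → Fin 7 → ℝ)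
    (ha : ∀ p q, omega0 (a p) (a q) = symplecticGram p q) (z : Fin 7 → ℝ) :
    bigOmega0 (a 0) (a 1) z + bigOmega0 (a 2) (a 3) z + bigOmega0 (a 4) (a 5) z = 0 := by
  let M : Matrix (Fin 6) (Fin 6) ℝ := Matrix.of fun i p => a p i.succ
  have hM : M.transpose * symplecticGram * M = symplecticGram := by
    ext p q
    rw [← ha p q]
    simp [M, Matrix.mul_apply, Fin.sum_univ_six, symplecticGram, omega0, dxdx]
    ring
  have hdual (i j : Fin 6) :
      a 0 i.succ * a 1 j.succ - a 1 i.succ * a 0 j.succ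
        + (a 2 i.succ * a 3 j.succ - a 3 i.succ * a 2 j.succ)
        + (a 4 i.succ * a 5 j.succ - a 5 i.succ * a 4 j.succ) = symplecticGram i j := by
    rw [← mul_symplecticGram_mul_transpose hM]
    simp [M, Matrix.mul_apply, Fin.sum_univ_six, symplecticGram]
    ring
  have h13 := hdual 0 2
  have h14 := hdual 0 3
  have h15 := hdual 0 4
  have h16 := hdual 0 5
  have h23 := hdual 1 2
  have h24 := hdual 1 3
  have h25 := hdual 1 4
  have h26 := hdual 1 5
  have h35 := hdual 2 4
  have h36 := hdual 2 5
  have h45 := hdual 3 4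
  have h46 := hdual 3 5
  simp [symplecticGram] at h13 h14 h15 h16 h23 h24 h25 h26 h35 h36 h45 h46
  simp only [bigOmega0, dxdxdx, Matrix.det_fin_three, Matrix.of_apply,
    Matrix.cons_val', Matrix.cons_val_zero, Matrix.cons_val_one, Matrix.cons_val,
    Matrix.cons_val_fin_one]
  linear_combination z 5 * h13 - z 3 * h15 + z 1 * h35
    - (z 6 * h14 - z 4 * h16 + z 1 * h46) - (z 6 * h23 - z 3 * h26 + z 2 * h36)
    - (z 5 * h24 - z 4 * h25 + z 2 * h45)

theorem omega0_map_eq {A : (Fin 7 → ℝ) →ₗ[ℝ] (Fin 7 → ℝ)}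
    (hA : ∀ u v w, phi0 (A u) (A v) (A w) = phi0 u v w) (he : A e1 = e1) (u v : Fin 7 → ℝ) :
    omega0 (A u) (A v) = omega0 u v := by
  rw [← phi0_e1_left, ← phi0_e1_left, ← hA e1 u v, he]

theorem map_apply_zero_eq {A : (Fin 7 → ℝ) →ₗ[ℝ] (Fin 7 → ℝ)}
    (hA : ∀ u v w, phi0 (A u) (A v) (A w) = phi0 u v w) (he : A e1 = e1) (w : Fin 7 → ℝ) :
    A w 0 = w 0 := by
  have hω := omega0_map_eq hA he
  let f : Fin 6 → Fin 7 → ℝ := fun p => Pi.single p.succ 1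
  have hf (p q : Fin 6) : omega0 (f p) (f q) = symplecticGram p q := omega0_single_succ p q
  have hΩ := bigOmega0_contract_eq_zero (fun p => A (f p))
    (fun p q => (hω _ _).trans (hf p q)) (A w)
  have hΩ' := bigOmega0_contract_eq_zero f hf w
  have h1 := hA (f 0) (f 1) w
  have h2 := hA (f 2) (f 3) w
  have h3 := hA (f 4) (f 5) w
  simp only [phi0_eq, hω, hf] at h1 h2 h3
  have hw : A w 0 = w 0 + w 1 * A (f 0) 0 + w 2 * A (f 1) 0 + w 3 * A (f 2) 0
      + w 4 * A (f 3) 0 + w 5 * A (f 4) 0 + w 6 * A (f 5) 0 := by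
    have he0 : A (Pi.single 0 1) 0 = 1 := by
      rw [show Pi.single 0 1 = e1 from rfl, he]
      simp [e1]
    have hs : w = ∑ i, w i • (Pi.single i 1 : Fin 7 → ℝ) := pi_eq_sum_univ' w
    conv_lhs => rw [hs]
    simp [Fin.sum_univ_seven, he0, f]
  simp [f, omega0, dxdx, symplecticGram] at h1 h2 h3
  simp [f] at hΩ hΩ' hw
  linarith

/-- The stabiliser in `G₂` of the vector `e₁` preserves the standard `SU(3)`-structure
on the orthogonal complement of `e₁`. -/
theorem g2_vector_stabiliser_SU3 (A : (Fin 7 → ℝ) ≃ₗ[ℝ] (Fin 7 → ℝ))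
    (hA : ∀ u v w : Fin 7 → ℝ, phi0 (A u) (A v) (A w) = phi0 u v w)
    (he : A e1 = e1) :
    (A '' {u : Fin 7 → ℝ | ∑ i, u i * e1 i = 0} = {u : Fin 7 → ℝ | ∑ i, u i * e1 i = 0}) ∧
    (∀ u v : Fin 7 → ℝ, omega0 (A u) (A v) = omega0 u v) ∧
    (∀ u v w : Fin 7 → ℝ, bigOmega0 (A u) (A v) (A w) = bigOmega0 u v w) := by
  have hω := omega0_map_eq (A := A.toLinearMap) hA he
  have h0 := map_apply_zero_eq (A := A.toLinearMap) hA he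
  simp only [LinearEquiv.coe_coe] at hω h0
  refine ⟨?_, hω, fun u v w => ?_⟩
  · have hmem (u : Fin 7 → ℝ) : ∑ i, u i * e1 i = u 0 := by simp [e1, Pi.single_apply]
    ext u
    simp only [hmem, Set.mem_image, Set.mem_ofPred_eq]
    refine ⟨?_, fun hu => ⟨A.symm u, ?_, A.apply_symm_apply u⟩⟩
    · rintro ⟨v, hv, rfl⟩
      rw [h0, hv]
    · rw [← h0 (A.symm u), A.apply_symm_apply, hu]
  · have h := hA u v w
    rw [phi0_eq, phi0_eq] at h
    simpa only [hω, h0, add_left_inj] using h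
end
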